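/- Let λ ≤ 0, n ≥ 2, and −λ − 1/(2√π) ≤ b < −λ. Let h : [0, r₁) → ℝ be C² with h(0) = b + λ < 0, h'(0) = 0, h' ≥ 0, h'' > 0 and h ≤ 0 on [0, r₁), satisfying h''/(1+(h')²) = (r − (n−1)/r)·h' − h − 2λ − λ·(√(1+(h')²) − 1) wherever r > 0 — equivalently, h + λ solves the profile ODE — and suppose there exists r' ∈ (0, r₁) with h'(r') = 1. Then r' ≥ √(log(−1/(2√π(b+λ)))) + λ. -/

import Mathlib

/-- Energy estimate for the profile equation: the quantity
`log (1 + h'²) / 2 - C h + h² / 2` is nonincreasing up to the point where the slope is `1`,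
for `C = r' - (1 + √2) lam`. -/
lemma energy_le_of_profile {n : ℕ} (hn : 1 ≤ n) {lam r' : ℝ} (hlam : lam ≤ 0) (hr' : 0 < r')
    {h : ℝ → ℝ}
    (hreg : ∀ r ∈ Set.Icc 0 r', DifferentiableAt ℝ h r ∧ DifferentiableAt ℝ (deriv h) r)
    (h0' : deriv h 0 = 0)
    (hmono : ∀ r ∈ Set.Icc 0 r', 0 ≤ deriv h r)
    (hconv : ∀ r ∈ Set.Icc 0 r', 0 < deriv (deriv h) r)
    (hode : ∀ r ∈ Set.Ioo 0 r',
      deriv (deriv h) r / (1 + (deriv h r) ^ 2) =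
        (r - ((n : ℝ) - 1) / r) * deriv h r - h r - 2 * lam
          - lam * (Real.sqrt (1 + (deriv h r) ^ 2) - 1))
    (hslope : deriv h r' = 1) :
    Real.log 2 / 2 - (r' - (1 + √2) * lam) * h r' + h r' ^ 2 / 2 ≤
      -(r' - (1 + √2) * lam) * h 0 + h 0 ^ 2 / 2 := by
  set C := r' - (1 + √2) * lam with hC
  have slope_le : ∀ r ∈ Set.Icc 0 r', deriv h r ≤ 1 := by
    have hm : MonotoneOn (deriv h) (Set.Icc 0 r') := by
      apply monotoneOn_of_deriv_nonneg (convex_Icc 0 r')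
      · exact fun r hr => (hreg r hr).2.continuousAt.continuousWithinAt
      · exact fun r hr => (hreg r (interior_subset hr)).2.differentiableWithinAt
      · exact fun r hr => (hconv r (interior_subset hr)).le
    exact fun r hr => hslope ▸ hm hr (Set.right_mem_Icc.2 hr'.le) hr.2
  have hder : ∀ r ∈ Set.Icc 0 r',
      HasDerivAt (fun r => Real.log (1 + deriv h r ^ 2) / 2 - C * h r + h r ^ 2 / 2)
        (deriv h r * (deriv (deriv h) r / (1 + deriv h r ^ 2) - C + h r)) r := by
    intro r hr
    have d1 := (hreg r hr).1.hasDerivAt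
    have d2 := (hreg r hr).2.hasDerivAt
    have hpos : (1 : ℝ) + deriv h r ^ 2 ≠ 0 := by positivity
    refine HasDerivAt.congr_deriv (((((d2.pow 2).const_add 1).log hpos).div_const 2 |>.sub (d1.const_mul C)).add
      ((d1.pow 2).div_const 2)) ?_
    simp only [Pi.pow_apply]
    push_cast
    ring
  have hanti : AntitoneOn
      (fun r => Real.log (1 + deriv h r ^ 2) / 2 - C * h r + h r ^ 2 / 2) (Set.Icc 0 r') := by
    apply antitoneOn_of_deriv_nonpos (convex_Icc 0 r')
    · exact fun r hr => (hder r hr).continuousAt.continuousWithinAt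
    · exact fun r hr =>
        (hder r (interior_subset hr)).differentiableAt.differentiableWithinAt
    · intro r hr
      rw [interior_Icc] at hr
      have hrI := Set.Ioo_subset_Icc_self hr
      rw [(hder r hrI).deriv, hode r hr]
      have p0 := hmono r hrI
      have p1 := slope_le r hrI
      apply mul_nonpos_of_nonneg_of_nonpos p0
      have hsqrt : √(1 + deriv h r ^ 2) ≤ √2 := Real.sqrt_le_sqrt (by nlinarith)
      have hdrag : 0 ≤ ((n : ℝ) - 1) / r * deriv h r := by
        have : (1 : ℝ) ≤ n := by exact_mod_cast hn
        exact mul_nonneg (div_nonneg (by linarith) hr.1.le) p0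
      have hrp : r * deriv h r ≤ r' := by nlinarith [hr.1, hr.2]
      nlinarith [mul_nonneg (neg_nonneg.2 hlam) (sub_nonneg.2 hsqrt)]
  have hends := hanti (Set.left_mem_Icc.2 hr'.le) (Set.right_mem_Icc.2 hr'.le) hr'.le
  simp only [hslope, h0'] at hends
  norm_num at hends
  linarith

lemma mul_exp_neg_sq_le {L : ℝ} : L * Real.exp (-L ^ 2) ≤ 0.44 := by
  rw [Real.exp_neg, ← div_eq_mul_inv, div_le_iff₀ (Real.exp_pos _)]
  have := Real.quadratic_le_exp_of_nonneg (sq_nonneg L)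
  nlinarith [sq_nonneg (L ^ 2 - 0.55), sq_nonneg (L - 0.733)]

/-- Lower bound for the first point with slope `1`: if `h = f + λ` where `f` solves the
profile ODE with `f(0) = b`, `f'(0) = 0`, `−λ − 1/(2√π) ≤ b < −λ`, `λ ≤ 0`, with `h' ≥ 0`,
`h'' > 0`, `h ≤ 0` on `[0,r₁)`, and `h'(r') = 1` for some `r' ∈ (0,r₁)`, then
`r' ≥ √(log(−1/(2√π(b+λ)))) + λ`. -/
theorem stmt_14 (n : ℕ) (hn : 2 ≤ n) (lam b r₁ : ℝ) (hlam : lam ≤ 0)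
    (hb1 : -lam - 1 / (2 * Real.sqrt Real.pi) ≤ b) (hb2 : b < -lam) (hr₁ : 0 < r₁)
    (h : ℝ → ℝ)
    (hreg : ∀ r ∈ Set.Ico 0 r₁, DifferentiableAt ℝ h r ∧ DifferentiableAt ℝ (deriv h) r)
    (h0 : h 0 = b + lam) (h0' : deriv h 0 = 0)
    (hmono : ∀ r ∈ Set.Ico 0 r₁, 0 ≤ deriv h r)
    (hconv : ∀ r ∈ Set.Ico 0 r₁, 0 < deriv (deriv h) r)
    (hneg : ∀ r ∈ Set.Ico 0 r₁, h r ≤ 0)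
    (hode : ∀ r ∈ Set.Ioo 0 r₁,
      deriv (deriv h) r / (1 + (deriv h r) ^ 2) =
        (r - ((n : ℝ) - 1) / r) * deriv h r - h r - 2 * lam
          - lam * (Real.sqrt (1 + (deriv h r) ^ 2) - 1))
    (r' : ℝ) (hr' : r' ∈ Set.Ioo 0 r₁) (hslope : deriv h r' = 1) :
    Real.sqrt (Real.log (-1 / (2 * Real.sqrt Real.pi * (b + lam)))) + lam ≤ r' := by
  by_contra! hlt
  set L := √(Real.log (-1 / (2 * √Real.pi * (b + lam)))) with hL
  have hrpos : 0 < r' := hr'.1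
  have hLpos : 0 < L := by linarith
  have hsub : Set.Icc 0 r' ⊆ Set.Ico 0 r₁ := fun r hr => ⟨hr.1, hr.2.trans_lt hr'.2⟩
  have hsub' : Set.Ioo 0 r' ⊆ Set.Ioo 0 r₁ := fun r hr => ⟨hr.1, hr.2.trans hr'.2⟩
  have energy := energy_le_of_profile (by omega : 1 ≤ n) hlam hrpos (fun r hr => hreg r (hsub hr))
    h0' (fun r hr => hmono r (hsub hr)) (fun r hr => hconv r (hsub hr))
    (fun r hr => hode r (hsub' hr)) hslope
  have hend := hneg r' ⟨hrpos.le, hr'.2⟩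
  rw [h0] at energy
  have hsπ : (1.77 : ℝ) ≤ √Real.pi :=
    Real.le_sqrt_of_sq_le (by linarith [Real.pi_gt_d2])
  have hs2 : √2 ≤ (1.4143 : ℝ) := Real.sqrt_le_iff.2 (by norm_num)
  have hs2' : 0 ≤ √(2 : ℝ) := Real.sqrt_nonneg 2
  obtain ⟨ε, hε⟩ : ∃ ε, ε = -(b + lam) := ⟨_, rfl⟩
  have hεpos : 0 < ε := by linarith
  have hbε : b + lam = -ε := by linarith
  have hexp : ε * (2 * √Real.pi) = Real.exp (-L ^ 2) := by
    have hsq : L ^ 2 = Real.log (-1 / (2 * √Real.pi * (b + lam))) :=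
      Real.sq_sqrt (Real.sqrt_pos.1 hLpos).le
    have harg : -1 / (2 * √Real.pi * (b + lam)) = (ε * (2 * √Real.pi))⁻¹ := by
      rw [hbε]
      field_simp
    rw [hsq, harg, Real.log_inv, neg_neg, Real.exp_log (by positivity)]
  have hexp_le : Real.exp (-L ^ 2) ≤ 1 := Real.exp_le_one_iff.2 (by nlinarith)
  have hε_le : ε ≤ 0.2825 := by nlinarith
  have hLε : L * ε ≤ 0.1243 := by
    have := mul_exp_neg_sq_le (L := L)
    rw [← hexp] at this
    nlinarith [mul_pos hLpos hεpos]
  have hC : r' - (1 + √2) * lam ≤ 2.4143 * L := by nlinarith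
  have hC0 : 0 ≤ r' - (1 + √2) * lam := by nlinarith
  rw [hbε] at energy
  have hCε : (r' - (1 + √2) * lam) * ε ≤ 2.4143 * L * ε :=
    mul_le_mul_of_nonneg_right hC hεpos.le
  have hCh : (r' - (1 + √2) * lam) * h r' ≤ 0 := mul_nonpos_of_nonneg_of_nonpos hC0 hend
  have hεsq : ε ^ 2 ≤ 0.0799 := by nlinarith
  nlinarith [Real.log_two_gt_d9, sq_nonneg (h r')]
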